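/- arXiv:2407.05653 — 2 statements merged into one kernel-verified Lean document; each statement's English description precedes it below -/
import Mathlib

section
/- Let G be an r-regular simple graph of order m, and let G₁ and G₂ be Laplacian cospectral simple graphs of the same order n whose Laplacian coronals are equal, i.e., χ_{L₁}(x) = χ_{L₂}(x) for every real x with det(xIₙ − L₁) ≠ 0 and det(xIₙ − L₂) ≠ 0. Then the Laplacian matrices L(G⊠G₁) and L(G⊠G₂) of the closed neighborhood coronas have equal characteristic polynomials. -/
open Matrix Polynomial Finset
open scoped Kronecker

/-- Adjacency matrix of the closed neighborhood corona `G₁ ⊠ G₂`, given the adjacency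
matrices `A₁`, `A₂` of the factors:
`[[A₁, 1ᵀ ⊗ (I + A₁)], [1 ⊗ (I + A₁), A₂ ⊗ I]]`. -/
noncomputable def cncAdj {n₁ n₂ : ℕ} (A₁ : Matrix (Fin n₁) (Fin n₁) ℝ)
    (A₂ : Matrix (Fin n₂) (Fin n₂) ℝ) :
    Matrix (Fin n₁ ⊕ Fin n₂ × Fin n₁) (Fin n₁ ⊕ Fin n₂ × Fin n₁) ℝ :=
  Matrix.fromBlocks A₁
    (Matrix.of fun i p => (1 + A₁) i p.2)
    (Matrix.of fun p j => (1 + A₁) p.2 j)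
    (A₂ ⊗ₖ (1 : Matrix (Fin n₁) (Fin n₁) ℝ))

/-- Degree matrix of the closed neighborhood corona, given the degree matrices of the factors:
`diag((n₂+1)D₁ + n₂ I, D₂ ⊗ I + I ⊗ (D₁ + I))`. -/
noncomputable def cncDeg {n₁ n₂ : ℕ} (D₁ : Matrix (Fin n₁) (Fin n₁) ℝ)
    (D₂ : Matrix (Fin n₂) (Fin n₂) ℝ) :
    Matrix (Fin n₁ ⊕ Fin n₂ × Fin n₁) (Fin n₁ ⊕ Fin n₂ × Fin n₁) ℝ :=
  Matrix.fromBlocks (((n₂ : ℝ) + 1) • D₁ + (n₂ : ℝ) • 1) 0 0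
    (D₂ ⊗ₖ (1 : Matrix (Fin n₁) (Fin n₁) ℝ) + (1 : Matrix (Fin n₂) (Fin n₂) ℝ) ⊗ₖ (D₁ + 1))

/-- Laplacian matrix of the closed neighborhood corona. -/
noncomputable def cncLap {n₁ n₂ : ℕ} (A₁ D₁ : Matrix (Fin n₁) (Fin n₁) ℝ)
    (A₂ D₂ : Matrix (Fin n₂) (Fin n₂) ℝ) :
    Matrix (Fin n₁ ⊕ Fin n₂ × Fin n₁) (Fin n₁ ⊕ Fin n₂ × Fin n₁) ℝ :=
  cncDeg D₁ D₂ - cncAdj A₁ A₂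

/-- Signless Laplacian matrix of the closed neighborhood corona. -/
noncomputable def cncSignlessLap {n₁ n₂ : ℕ} (A₁ D₁ : Matrix (Fin n₁) (Fin n₁) ℝ)
    (A₂ D₂ : Matrix (Fin n₂) (Fin n₂) ℝ) :
    Matrix (Fin n₁ ⊕ Fin n₂ × Fin n₁) (Fin n₁ ⊕ Fin n₂ × Fin n₁) ℝ :=
  cncDeg D₁ D₂ + cncAdj A₁ A₂

/-- The coronal of a matrix `M` of order `n`: the sum of all entries of `(xIₙ - M)⁻¹`,
i.e. `1ₙᵀ (xIₙ - M)⁻¹ 1ₙ`. -/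
noncomputable def coronal {n : ℕ} (M : Matrix (Fin n) (Fin n) ℝ) (x : ℝ) : ℝ :=
  ∑ i, ∑ j, (x • (1 : Matrix (Fin n) (Fin n) ℝ) - M)⁻¹ i j

/-- Signless Laplacian of a simple graph: `Q = D + A`. -/
noncomputable def signlessLap {V : Type*} [Fintype V] [DecidableEq V] (G : SimpleGraph V)
    [DecidableRel G.Adj] : Matrix V V ℝ :=
  G.degMatrix ℝ + G.adjMatrix ℝ

/-- The energy of a (symmetric) real matrix: the sum of the absolute values of the roots of its
characteristic polynomial, counted with multiplicity.  For a real symmetric matrix the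
characteristic polynomial splits over `ℝ`, so these are exactly its eigenvalues with
multiplicity. -/
noncomputable def menergy {n : Type*} [Fintype n] [DecidableEq n] (A : Matrix n n ℝ) : ℝ :=
  (A.charpoly.roots.map (fun t => |t|)).sum

/-- Determinant of a block matrix of corona type, by the Schur complement of its lower right
block `K ⊗ I`. -/
theorem det_fromBlocks_corona {m n : ℕ} (P N : Matrix (Fin m) (Fin m) ℝ)
    (K : Matrix (Fin n) (Fin n) ℝ) (hK : K.det ≠ 0) :
    (Matrix.fromBlocks P (Matrix.of fun i (p : Fin n × Fin m) => N i p.2)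
      (Matrix.of fun (p : Fin n × Fin m) j => N p.2 j)
      (K ⊗ₖ (1 : Matrix (Fin m) (Fin m) ℝ))).det
      = K.det ^ m * (P - (∑ i, ∑ j, K⁻¹ i j) • (N * N)).det := by
  have hmul : (K⁻¹ ⊗ₖ (1 : Matrix (Fin m) (Fin m) ℝ)) * (K ⊗ₖ (1 : Matrix (Fin m) (Fin m) ℝ))
      = 1 := by
    rw [← Matrix.mul_kronecker_mul, Matrix.nonsing_inv_mul _ hK.isUnit, Matrix.one_mul,
      Matrix.one_kronecker_one]
  let : Invertible (K ⊗ₖ (1 : Matrix (Fin m) (Fin m) ℝ)) :=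
    ⟨_, hmul, mul_eq_one_comm.mp hmul⟩
  rw [Matrix.det_fromBlocks₂₂, Matrix.det_kronecker, Matrix.det_one, one_pow, mul_one,
    Fintype.card_fin]
  congr 3
  rw [invOf_eq_left_inv hmul]
  ext a b
  simp only [Matrix.mul_apply, Matrix.of_apply, Matrix.kroneckerMap_apply, Fintype.sum_prod_type,
    Matrix.one_apply, mul_ite, mul_one, mul_zero, Finset.sum_ite_eq', Finset.mem_univ, if_true,
    Matrix.smul_apply, smul_eq_mul]
  rw [Finset.sum_comm, Finset.sum_comm (f := fun i j => K⁻¹ i j), Finset.mul_sum]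
  refine Finset.sum_congr rfl fun k _ => ?_
  rw [Finset.sum_mul]
  refine Finset.sum_congr rfl fun j _ => ?_
  rw [← Finset.mul_sum]
  ring

/-- Evaluation of the Laplacian characteristic polynomial of a closed neighborhood corona with
regular first factor. -/
theorem eval_charpoly_cncLap {m n r : ℕ} (G : SimpleGraph (Fin m)) [DecidableRel G.Adj]
    (hreg : G.IsRegularOfDegree r) (H : SimpleGraph (Fin n)) [DecidableRel H.Adj] (x : ℝ)
    (hx : ((x - (r + 1)) • (1 : Matrix (Fin n) (Fin n) ℝ) - H.lapMatrix ℝ).det ≠ 0) :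
    (cncLap (G.adjMatrix ℝ) (G.degMatrix ℝ) (H.adjMatrix ℝ) (H.degMatrix ℝ)).charpoly.eval x
      = ((x - (r + 1)) • (1 : Matrix (Fin n) (Fin n) ℝ) - H.lapMatrix ℝ).det ^ m
        * (x • 1 - (((n : ℝ) + 1) • G.degMatrix ℝ + (n : ℝ) • 1) + G.adjMatrix ℝ
          - coronal (H.lapMatrix ℝ) (x - (r + 1)) •
            ((1 + G.adjMatrix ℝ) * (1 + G.adjMatrix ℝ))).det := by
  rw [Matrix.eval_charpoly, coronal, ← det_fromBlocks_corona _ _ _ hx]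
  congr 1
  have hdeg : G.degMatrix ℝ = (r : ℝ) • 1 := by
    ext i j
    simp [SimpleGraph.degMatrix, Matrix.diagonal_apply, Matrix.one_apply, hreg.degree_eq]
  ext (i | ⟨i, i'⟩) (j | ⟨j, j'⟩)
  · simp [cncLap, cncDeg, cncAdj, Matrix.diagonal_apply, Matrix.one_apply]
    ring
  · simp [cncLap, cncDeg, cncAdj]
  · simp [cncLap, cncDeg, cncAdj]
  · simp only [cncLap, cncDeg, cncAdj, hdeg, SimpleGraph.lapMatrix]
    by_cases h₁ : i = j <;> by_cases h₂ : i' = j' <;>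
      simp [Matrix.one_apply, h₁, h₂]
    ring

/-- The determinant `det (x I - M)` is the value of the characteristic polynomial at `x`. -/
theorem det_smul_one_sub {n : ℕ} (M : Matrix (Fin n) (Fin n) ℝ) (x : ℝ) :
    (x • (1 : Matrix (Fin n) (Fin n) ℝ) - M).det = M.charpoly.eval x := by
  rw [Matrix.eval_charpoly, Matrix.scalar_apply, Matrix.smul_one_eq_diagonal]

/-- If `G` is `r`-regular and `G₁`, `G₂` are Laplacian cospectral with equal Laplacian
coronals, then `G ⊠ G₁` and `G ⊠ G₂` are Laplacian cospectral. -/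
theorem cnc_lap_cospectral_right {m n r : ℕ} (G : SimpleGraph (Fin m)) [DecidableRel G.Adj]
    (hreg : G.IsRegularOfDegree r)
    (G₁ G₂ : SimpleGraph (Fin n)) [DecidableRel G₁.Adj] [DecidableRel G₂.Adj]
    (h : (G₁.lapMatrix ℝ).charpoly = (G₂.lapMatrix ℝ).charpoly)
    (hcor : ∀ x : ℝ, (x • (1 : Matrix (Fin n) (Fin n) ℝ) - G₁.lapMatrix ℝ).det ≠ 0 →
      (x • (1 : Matrix (Fin n) (Fin n) ℝ) - G₂.lapMatrix ℝ).det ≠ 0 →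
      coronal (G₁.lapMatrix ℝ) x = coronal (G₂.lapMatrix ℝ) x) :
    (cncLap (G.adjMatrix ℝ) (G.degMatrix ℝ) (G₁.adjMatrix ℝ) (G₁.degMatrix ℝ)).charpoly
      = (cncLap (G.adjMatrix ℝ) (G.degMatrix ℝ) (G₂.adjMatrix ℝ) (G₂.degMatrix ℝ)).charpoly := by
  have hq : (G₁.lapMatrix ℝ).charpoly.comp (X - C ((r : ℝ) + 1)) ≠ 0 :=
    ((Matrix.charpoly_monic _).comp_X_sub_C _).ne_zero
  refine mul_right_cancel₀ hq (Polynomial.funext fun x => ?_)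
  rw [eval_mul, eval_mul, eval_comp, eval_sub, eval_X, eval_C, ← det_smul_one_sub]
  have hdet : ((x - (r + 1)) • (1 : Matrix (Fin n) (Fin n) ℝ) - G₁.lapMatrix ℝ).det
      = ((x - (r + 1)) • (1 : Matrix (Fin n) (Fin n) ℝ) - G₂.lapMatrix ℝ).det := by
    rw [det_smul_one_sub, det_smul_one_sub, h]
  by_cases hx : ((x - (r + 1)) • (1 : Matrix (Fin n) (Fin n) ℝ) - G₁.lapMatrix ℝ).det = 0
  · rw [hx, mul_zero, mul_zero]
  · have hx' := hdet ▸ hx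
    rw [eval_charpoly_cncLap G hreg G₁ x hx, eval_charpoly_cncLap G hreg G₂ x hx',
      hcor _ hx hx', hdet]
end

section
/- Let G₁ be an r₁-regular simple graph of order n₁ (so its degree matrix is D₁ = r₁I_{n₁}) with signless Laplacian eigenvalues ν₁₁,…,ν₁ₙ₁ listed with multiplicity, and let G₂ be an arbitrary simple graph of order n₂ with signless Laplacian matrix Q₂. Then for every real x with det((x−r₁−1)I_{n₂} − Q₂) ≠ 0, det(xI_{n₁(1+n₂)} − Q(G₁⊠G₂)) = det((x−(r₁+1))I_{n₂} − Q₂)^{n₁} · ∏_{i=1}^{n₁} [ x − n₂(r₁+1) − ν₁ᵢ − χ_{Q₂}(x−(r₁+1))·(1−r₁+ν₁ᵢ)² ]. -/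
open Matrix Polynomial Finset
open scoped Kronecker

/-- A real symmetric matrix whose characteristic polynomial has roots `nu` satisfies
`det (p(A)) = ∏ p(nu i)`. -/
theorem Matrix.IsHermitian.det_aeval_eq_prod {n : Type*} [Fintype n] [DecidableEq n]
    {A : Matrix n n ℝ} (hA : A.IsHermitian) {nu : n → ℝ}
    (hnu : A.charpoly = ∏ i, (X - C (nu i))) (p : ℝ[X]) :
    (aeval A p).det = ∏ i, p.eval (nu i) := by
  have hroots : univ.val.map hA.eigenvalues = univ.val.map nu := by
    have h := congrArg Polynomial.roots (hA.charpoly_eq.symm.trans hnu)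
    simpa [Polynomial.roots_prod, Finset.prod_ne_zero_iff, Polynomial.X_sub_C_ne_zero,
      Multiset.bind_singleton] using h
  have hdiag (d : n → ℝ) : (aeval (diagonal d) p).det = ∏ i, p.eval (d i) := by
    have h := Polynomial.aeval_algHom_apply (diagonalAlgHom (n := n) (α := ℝ) ℝ) d p
    simp only [diagonalAlgHom_apply] at h
    rw [h, det_diagonal]
    refine Finset.prod_congr rfl fun i _ => ?_
    simp [Polynomial.coe_aeval_eq_eval]
  have hev : (aeval A p).det = ∏ i, p.eval (hA.eigenvalues i) := by
    conv_lhs => rw [hA.spectral_theorem, Polynomial.aeval_algHom_apply,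
      Unitary.conjStarAlgAut_apply, det_mul_comm, ← mul_assoc]
    simpa using hdiag hA.eigenvalues
  rw [hev]
  have h := congrArg (fun s => (s.map fun t => p.eval t).prod) hroots
  simpa [Multiset.map_map, Function.comp_def] using h

/-- Sandwiching `M ⊗ 1` between a row and a column of copies of `B` and `C` sums the
entries of `M`. -/
theorem of_mul_kronecker_one_mul_of {m n R : Type*} [Fintype m] [Fintype n] [DecidableEq n]
    [CommSemiring R] (M : Matrix m m R) (B C : Matrix n n R) :
    (of fun i (q : m × n) => B i q.2) * (M ⊗ₖ (1 : Matrix n n R)) *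
        (of fun (q : m × n) j => C q.2 j) = (∑ a, ∑ b, M a b) • (B * C) := by
  ext i j
  have hcomm : ∑ a, ∑ b, M a b = ∑ b, ∑ a, M a b := Finset.sum_comm
  rw [hcomm, Matrix.smul_apply, smul_eq_mul, mul_apply, mul_apply, Finset.sum_mul_sum,
    Fintype.sum_prod_type]
  refine Finset.sum_congr rfl fun b _ => Finset.sum_congr rfl fun k _ => ?_
  simp only [mul_apply, of_apply, kroneckerMap_apply, one_apply, Fintype.sum_prod_type,
    mul_ite, mul_one, mul_zero, Finset.sum_ite_eq', Finset.mem_univ, if_true, Finset.sum_mul]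
  exact Finset.sum_congr rfl fun a _ => by ring

theorem SimpleGraph.IsRegularOfDegree.degMatrix_eq {V R : Type*} [Fintype V] [DecidableEq V]
    [NonAssocSemiring R] {G : SimpleGraph V} [DecidableRel G.Adj] {r : ℕ}
    (h : G.IsRegularOfDegree r) : G.degMatrix R = (r : R) • 1 := by
  ext i j
  simp [SimpleGraph.degMatrix, diagonal_apply, one_apply, h.degree_eq i]

theorem isHermitian_signlessLap {V : Type*} [Fintype V] [DecidableEq V] (G : SimpleGraph V)
    [DecidableRel G.Adj] : (signlessLap G).IsHermitian :=
  (G.isHermitian_degMatrix ℝ).add (G.isHermitian_adjMatrix (R := ℝ))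

/-- Signless Laplacian characteristic polynomial of the closed neighborhood corona, for `G₁`
an `r₁`-regular graph. -/
theorem cnc_signlessLap_charpoly {n₁ n₂ r₁ : ℕ}
    (G₁ : SimpleGraph (Fin n₁)) (G₂ : SimpleGraph (Fin n₂))
    [DecidableRel G₁.Adj] [DecidableRel G₂.Adj]
    (hreg : G₁.IsRegularOfDegree r₁)
    (nu : Fin n₁ → ℝ)
    (hnu : (signlessLap G₁).charpoly = ∏ i, (X - C (nu i))) :
    ∀ x : ℝ,
      ((x - (r₁ : ℝ) - 1) • (1 : Matrix (Fin n₂) (Fin n₂) ℝ) - signlessLap G₂).det ≠ 0 →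
      (x • (1 : Matrix (Fin n₁ ⊕ Fin n₂ × Fin n₁) (Fin n₁ ⊕ Fin n₂ × Fin n₁) ℝ)
          - cncSignlessLap (G₁.adjMatrix ℝ) (G₁.degMatrix ℝ) (G₂.adjMatrix ℝ) (G₂.degMatrix ℝ)).det
        = ((x - ((r₁ : ℝ) + 1)) • (1 : Matrix (Fin n₂) (Fin n₂) ℝ) - signlessLap G₂).det ^ n₁ *
          ∏ i, (x - n₂ * ((r₁ : ℝ) + 1) - nu i
              - coronal (signlessLap G₂) (x - ((r₁ : ℝ) + 1)) * (1 - (r₁ : ℝ) + nu i) ^ 2) := by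
  intro x hx
  rw [sub_sub] at hx
  set y := x - ((r₁ : ℝ) + 1) with hy
  set M := y • (1 : Matrix (Fin n₂) (Fin n₂) ℝ) - signlessLap G₂ with hM
  set Q := signlessLap G₁ with hQ
  have hadj : G₁.adjMatrix ℝ = Q - (r₁ : ℝ) • 1 := by
    rw [hQ, signlessLap, hreg.degMatrix_eq, add_sub_cancel_left]
  set B : Matrix (Fin n₁) (Fin n₁) ℝ := (1 - (r₁ : ℝ)) • 1 + Q with hB
  have hblocks : x • (1 : Matrix (Fin n₁ ⊕ Fin n₂ × Fin n₁) (Fin n₁ ⊕ Fin n₂ × Fin n₁) ℝ)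
      - cncSignlessLap (G₁.adjMatrix ℝ) (G₁.degMatrix ℝ) (G₂.adjMatrix ℝ) (G₂.degMatrix ℝ)
      = fromBlocks ((x - n₂ * ((r₁ : ℝ) + 1)) • 1 - Q)
          (-(of fun i (q : Fin n₂ × Fin n₁) => B i q.2))
          (-(of fun (q : Fin n₂ × Fin n₁) j => B q.2 j)) (M ⊗ₖ 1) := by
    have hB' : 1 + G₁.adjMatrix ℝ = B := by rw [hadj, hB]; module
    rw [cncSignlessLap, cncDeg, cncAdj, hB', hreg.degMatrix_eq, hadj, ← fromBlocks_one,
      fromBlocks_smul, fromBlocks_add, sub_eq_add_neg, fromBlocks_neg, fromBlocks_add]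
    congr 1
    · module
    · simp
    · simp
    · rw [← sub_eq_add_neg, hM, hy, signlessLap]
      ext ⟨a, i⟩ ⟨b, j⟩
      by_cases hab : a = b <;> by_cases hij : i = j <;>
        (simp [one_apply, hab, hij]; try ring)
  have hdet : (M ⊗ₖ (1 : Matrix (Fin n₁) (Fin n₁) ℝ)).det = M.det ^ n₁ := by
    simp [det_kronecker]
  let : Invertible (M ⊗ₖ (1 : Matrix (Fin n₁) (Fin n₁) ℝ)) :=
    invertibleOfIsUnitDet _ (by rw [hdet]; exact (pow_ne_zero _ hx).isUnit)
  rw [hblocks, det_fromBlocks₂₂, hdet, invOf_eq_nonsing_inv, inv_kronecker, inv_one,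
    Matrix.neg_mul, Matrix.neg_mul, Matrix.mul_neg, neg_neg, of_mul_kronecker_one_mul_of]
  congr 1
  have hp := (isHermitian_signlessLap G₁).det_aeval_eq_prod hnu
    (C (x - n₂ * ((r₁ : ℝ) + 1)) - X
      - C (coronal (signlessLap G₂) y) * (C (1 - (r₁ : ℝ)) + X) ^ 2)
  simp only [eval_sub, eval_mul, eval_pow, eval_add, eval_C, eval_X] at hp
  rw [← hp]
  simp only [sq, map_sub, map_mul, map_add, aeval_C, aeval_X, Algebra.algebraMap_eq_smul_one,
    smul_mul_assoc, one_mul, coronal, ← hQ, ← hM, hB, sub_smul, one_smul]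
  congr 3
  module
end
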